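/- Let X, Y ≥ 1, let p be a probability vector on {1,…,X}, let B be an X×Y row-stochastic TP2 observation matrix with Σ_j B(j,y)·p(j) > 0 for every y, let c₁ ∈ ℝ^X be nondecreasing, let c₂ ∈ ℝ^X be nonincreasing, and let α ∈ (0,1] satisfy α ≥ 1 − η_y(X) for every y, where η_y(i) = B(i,y)·p(i)/Σ_j B(j,y)·p(j). Define a*(y) = 2 if CVaR_α(c₂;η_y) ≤ CVaR_α(c₁;η_y) and a*(y) = 1 otherwise. Then there exists a threshold l ∈ {1,…,Y+1} such that a*(y) = 1 for all y < l and a*(y) = 2 for all y ≥ l. Consequently, the decision rule y ↦ a*(y) lies in a set of at most Y+1 threshold rules, and the induced action-likelihood matrix R with entries R(i,a) = Σ_{y : a*(y)=a} B(i,y) takes at most Y+1 distinct values as the predicted belief p varies over all probability vectors satisfying the above hypotheses. -/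

import Mathlib

open Finset

/-- `hfun π c α z = z + (1/α) · ∑ i, π i · max (c i − z) 0`. -/
noncomputable def hfun {X : ℕ} (π c : Fin X → ℝ) (α z : ℝ) : ℝ :=
  z + (1 / α) * ∑ i, π i * max (c i - z) 0

/-- `CVaR_α(c; π) = inf_z hfun π c α z`. -/
noncomputable def CVaR {X : ℕ} (π c : Fin X → ℝ) (α : ℝ) : ℝ :=
  ⨅ z : ℝ, hfun π c α z

/-- Bayesian posterior of belief `p` after observation `y` through likelihood matrix `B`. -/
noncomputable def post {X Y : ℕ} (B : Fin X → Fin Y → ℝ) (p : Fin X → ℝ)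
    (y : Fin Y) (i : Fin X) : ℝ :=
  B i y * p i / ∑ j, B j y * p j

/-- The agent's CVaR-optimal trading decision after observation `y`:
action `2` (sell) if `CVaR_α(c₂; η_y) ≤ CVaR_α(c₁; η_y)`, else action `1` (buy). -/
noncomputable def astar {X Y : ℕ} (B : Fin X → Fin Y → ℝ) (p : Fin X → ℝ)
    (c₁ c₂ : Fin X → ℝ) (α : ℝ) (y : Fin Y) : ℕ :=
  if CVaR (post B p y) c₂ α ≤ CVaR (post B p y) c₁ α then 2 else 1

/-- The hypotheses on the predicted belief `p`: it is a probability vector, all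
observations have positive likelihood, and `α ≥ 1 − η_y(X)` for every `y`. -/
def Good {X Y : ℕ} (hX : 1 ≤ X) (B : Fin X → Fin Y → ℝ) (α : ℝ)
    (p : Fin X → ℝ) : Prop :=
  (∀ i, 0 ≤ p i) ∧ (∑ i, p i = 1) ∧ (∀ y, 0 < ∑ j, B j y * p j) ∧
    (∀ y : Fin Y, 1 - post B p y ⟨X - 1, by omega⟩ ≤ α)

/-- The induced action-likelihood matrix `R(i, a) = ∑_{y : a*(y) = a} B i y`,
with the two actions `1` (buy), `2` (sell) encoded by `Fin 2` via `a ↦ a + 1`. -/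
noncomputable def Rmat {X Y : ℕ} (B : Fin X → Fin Y → ℝ) (p : Fin X → ℝ)
    (c₁ c₂ : Fin X → ℝ) (α : ℝ) (i : Fin X) (a : Fin 2) : ℝ :=
  ∑ y ∈ univ.filter (fun y => astar B p c₁ c₂ α y = (a : ℕ) + 1), B i y

/-- A likelihood-ratio ordered pair of nonnegative weights has ordered expectations, in
cross-multiplied form. -/
lemma sum_mul_sum_le_of_likelihood_ratio {ι : Type*} [Fintype ι] [LinearOrder ι] (a b f : ι → ℝ)
    (hab : ∀ i j, i ≤ j → a j * b i ≤ a i * b j) (hf : Monotone f) :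
    (∑ i, a i * f i) * ∑ j, b j ≤ (∑ i, a i) * ∑ j, b j * f j := by
  have hsymm : 0 ≤ ∑ i, ∑ j, (a i * b j - a j * b i) * (f j - f i) := by
    refine sum_nonneg fun i _ => sum_nonneg fun j _ => ?_
    rcases le_total i j with h | h
    · exact mul_nonneg (sub_nonneg.2 (hab i j h)) (sub_nonneg.2 (hf h))
    · exact mul_nonneg_of_nonpos_of_nonpos (by linarith [hab j i h])
        (sub_nonpos.2 (hf h))
  have hexpand : ∑ i, ∑ j, (a i * b j - a j * b i) * (f j - f i) =
      2 * ((∑ i, a i) * (∑ j, b j * f j) - (∑ i, a i * f i) * ∑ j, b j) := by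
    have hterm : ∀ i j, (a i * b j - a j * b i) * (f j - f i) =
        a i * (b j * f j) - a i * f i * b j - (b i * (a j * f j) - b i * f i * a j) := by
      intro i j; ring
    simp only [hterm, sum_sub_distrib, ← sum_mul_sum]
    ring
  linarith

/-- Posteriors increase in first-order stochastic dominance with the observation. -/
lemma sum_post_mul_le_of_monotone {X Y : ℕ} {B : Fin X → Fin Y → ℝ} {p : Fin X → ℝ}
    (hTP2 : ∀ (i i' : Fin X) (y y' : Fin Y),
      i ≤ i' → y ≤ y' → B i y' * B i' y ≤ B i y * B i' y')
    (hp : ∀ i, 0 ≤ p i) (hpos : ∀ y, 0 < ∑ j, B j y * p j)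
    {f : Fin X → ℝ} (hf : Monotone f) {y y' : Fin Y} (hy : y ≤ y') :
    ∑ i, post B p y i * f i ≤ ∑ i, post B p y' i * f i := by
  have hpost : ∀ y, ∑ i, post B p y i * f i =
      (∑ i, B i y * p i * f i) / ∑ j, B j y * p j := by
    intro y
    simp only [post, sum_div]
    exact sum_congr rfl fun i _ => by ring
  rw [hpost, hpost, div_le_div_iff₀ (hpos y) (hpos y'), mul_comm (∑ i, B i y' * p i * f i)]
  refine sum_mul_sum_le_of_likelihood_ratio _ _ f (fun i j hij => ?_) hf
  have h := mul_le_mul_of_nonneg_right (hTP2 i j y y' hij hy) (mul_nonneg (hp i) (hp j))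
  linarith

lemma sum_post_eq_one {X Y : ℕ} {B : Fin X → Fin Y → ℝ} {p : Fin X → ℝ} {y : Fin Y}
    (hpos : 0 < ∑ j, B j y * p j) : ∑ i, post B p y i = 1 := by
  simp only [post, ← sum_div]
  exact div_self hpos.ne'

lemma bddBelow_range_hfun {X : ℕ} {π : Fin X → ℝ} (c : Fin X → ℝ) {α : ℝ}
    (hα : α ∈ Set.Ioc (0 : ℝ) 1) (hπ : ∀ i, 0 ≤ π i) (hsum : ∑ i, π i = 1) :
    BddBelow (Set.range (hfun π c α)) := by
  refine ⟨∑ i, π i * c i, ?_⟩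
  rintro _ ⟨z, rfl⟩
  have hexcess : ∑ i, π i * c i - z ≤ ∑ i, π i * max (c i - z) 0 := by
    calc ∑ i, π i * c i - z = ∑ i, π i * (c i - z) := by
          simp only [mul_sub, sum_sub_distrib, ← sum_mul, hsum, one_mul]
      _ ≤ _ := sum_le_sum fun i _ => mul_le_mul_of_nonneg_left (le_max_left _ _) (hπ i)
  have hscale : ∑ i, π i * max (c i - z) 0 ≤ 1 / α * ∑ i, π i * max (c i - z) 0 :=
    le_mul_of_one_le_left (sum_nonneg fun i _ => mul_nonneg (hπ i) (le_max_right _ _))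
      ((one_le_div hα.1).2 hα.2)
  unfold hfun
  linarith

lemma CVaR_le_CVaR {X : ℕ} {π π' c : Fin X → ℝ} {α : ℝ} (hα : α ∈ Set.Ioc (0 : ℝ) 1)
    (hπ : ∀ i, 0 ≤ π i) (hsum : ∑ i, π i = 1)
    (h : ∀ z, ∑ i, π i * max (c i - z) 0 ≤ ∑ i, π' i * max (c i - z) 0) :
    CVaR π c α ≤ CVaR π' c α := by
  refine ciInf_mono (bddBelow_range_hfun c hα hπ hsum) fun z => ?_
  exact add_le_add_right (mul_le_mul_of_nonneg_left (h z) (one_div_nonneg.2 hα.1.le)) z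

/-- Once selling is optimal, it stays optimal for every larger observation. -/
lemma CVaR_post_le_CVaR_post_of_le {X Y : ℕ} {B : Fin X → Fin Y → ℝ} {p : Fin X → ℝ}
    (hB0 : ∀ i y, 0 ≤ B i y)
    (hTP2 : ∀ (i i' : Fin X) (y y' : Fin Y),
      i ≤ i' → y ≤ y' → B i y' * B i' y ≤ B i y * B i' y')
    (hp : ∀ i, 0 ≤ p i) (hpos : ∀ y, 0 < ∑ j, B j y * p j)
    {c₁ c₂ : Fin X → ℝ} (hc₁ : Monotone c₁) (hc₂ : Antitone c₂)
    {α : ℝ} (hα : α ∈ Set.Ioc (0 : ℝ) 1) {y y' : Fin Y} (hy : y ≤ y')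
    (h : CVaR (post B p y) c₂ α ≤ CVaR (post B p y) c₁ α) :
    CVaR (post B p y') c₂ α ≤ CVaR (post B p y') c₁ α := by
  have hpost0 : ∀ y i, 0 ≤ post B p y i := fun y i =>
    div_nonneg (mul_nonneg (hB0 i y) (hp i)) (hpos y).le
  have h₁ : CVaR (post B p y) c₁ α ≤ CVaR (post B p y') c₁ α :=
    CVaR_le_CVaR hα (hpost0 y) (sum_post_eq_one (hpos y)) fun z =>
      sum_post_mul_le_of_monotone hTP2 hp hpos
        (fun i j hij => max_le_max_right 0 (sub_le_sub_right (hc₁ hij) z)) hy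
  have h₂ : CVaR (post B p y') c₂ α ≤ CVaR (post B p y) c₂ α := by
    refine CVaR_le_CVaR hα (hpost0 y') (sum_post_eq_one (hpos y')) fun z => ?_
    have := sum_post_mul_le_of_monotone hTP2 hp hpos (f := fun i => -max (c₂ i - z) 0)
      (fun i j hij => neg_le_neg (max_le_max_right 0 (sub_le_sub_right (hc₂ hij) z))) hy
    simpa only [mul_neg, sum_neg_distrib, neg_le_neg_iff] using this
  exact h₂.trans (h.trans h₁)

/-- An upward closed predicate on `Fin n` is decided by a threshold. -/
lemma exists_threshold_of_upward_closed {n : ℕ} (P : Fin n → Prop)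
    (hP : ∀ y y', y ≤ y' → P y → P y') :
    ∃ l : ℕ, l ≤ n ∧ ∀ y : Fin n, P y ↔ l ≤ (y : ℕ) := by
  classical
  have hex : ∃ m : ℕ, ∀ y : Fin n, m ≤ (y : ℕ) → P y :=
    ⟨n, fun y hy => absurd y.isLt (not_lt.2 hy)⟩
  refine ⟨Nat.find hex, Nat.find_min' hex fun y hy => absurd y.isLt (not_lt.2 hy), fun y => ?_⟩
  exact ⟨fun h => Nat.find_min' hex fun y' hy' => hP y y' hy' h, Nat.find_spec hex y⟩

/-- The CVaR-optimal decision rule is a threshold rule in the observation, so there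
are at most `Y + 1` possible rules and at most `Y + 1` distinct action-likelihood
matrices `R^π` as the belief varies. -/
theorem threshold_decision_rules (X Y : ℕ) (hX : 1 ≤ X) (hY : 1 ≤ Y)
    (B : Fin X → Fin Y → ℝ) (hB0 : ∀ i y, 0 ≤ B i y)
    (hBrow : ∀ i, ∑ y, B i y = 1)
    (hTP2 : ∀ (i i' : Fin X) (y y' : Fin Y),
      i ≤ i' → y ≤ y' → B i y' * B i' y ≤ B i y * B i' y')
    (c₁ c₂ : Fin X → ℝ) (hc₁ : Monotone c₁) (hc₂ : Antitone c₂)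
    (α : ℝ) (hα : α ∈ Set.Ioc (0 : ℝ) 1) :
    (∀ p : Fin X → ℝ, Good hX B α p →
      ∃ l : ℕ, l ≤ Y ∧ ∀ y : Fin Y,
        ((y : ℕ) < l → astar B p c₁ c₂ α y = 1) ∧
        (l ≤ (y : ℕ) → astar B p c₁ c₂ α y = 2)) ∧
    {R : Fin X → Fin 2 → ℝ |
        ∃ p : Fin X → ℝ, Good hX B α p ∧ R = Rmat B p c₁ c₂ α}.Finite ∧
    {R : Fin X → Fin 2 → ℝ |
        ∃ p : Fin X → ℝ, Good hX B α p ∧ R = Rmat B p c₁ c₂ α}.ncard ≤ Y + 1 := by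
  have hthreshold : ∀ p : Fin X → ℝ, Good hX B α p →
      ∃ l : ℕ, l ≤ Y ∧ ∀ y : Fin Y,
        ((y : ℕ) < l → astar B p c₁ c₂ α y = 1) ∧
        (l ≤ (y : ℕ) → astar B p c₁ c₂ α y = 2) := by
    rintro p ⟨hp, -, hpos, -⟩
    obtain ⟨l, hl, hiff⟩ := exists_threshold_of_upward_closed
      (fun y => CVaR (post B p y) c₂ α ≤ CVaR (post B p y) c₁ α)
      (fun _ _ hy => CVaR_post_le_CVaR_post_of_le hB0 hTP2 hp hpos hc₁ hc₂ hα hy)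
    exact ⟨l, hl, fun y => ⟨fun hy => if_neg fun h => absurd ((hiff y).1 h) (not_le.2 hy),
      fun hy => if_pos ((hiff y).2 hy)⟩⟩
  let ruleMat : ℕ → Fin X → Fin 2 → ℝ := fun l i a =>
    ∑ y ∈ univ.filter (fun y : Fin Y => (if l ≤ (y : ℕ) then 2 else 1) = (a : ℕ) + 1), B i y
  have hsub : {R : Fin X → Fin 2 → ℝ |
      ∃ p : Fin X → ℝ, Good hX B α p ∧ R = Rmat B p c₁ c₂ α} ⊆
      ruleMat '' (range (Y + 1) : Set ℕ) := by
    rintro _ ⟨p, hp, rfl⟩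
    obtain ⟨l, hl, h⟩ := hthreshold p hp
    refine ⟨l, by simpa using Nat.lt_succ_of_le hl, ?_⟩
    have hrule : ∀ y : Fin Y, (if l ≤ (y : ℕ) then 2 else 1) = astar B p c₁ c₂ α y := by
      intro y
      split_ifs with hy
      · exact ((h y).2 hy).symm
      · exact ((h y).1 (not_le.1 hy)).symm
    funext i a
    simp only [ruleMat, Rmat, hrule]
  have hfin : (ruleMat '' (range (Y + 1) : Set ℕ)).Finite := (finite_toSet _).image _
  refine ⟨hthreshold, hfin.subset hsub, (Set.ncard_le_ncard hsub hfin).trans ?_⟩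
  refine (Set.ncard_image_le (finite_toSet _)).trans ?_
  rw [Set.ncard_coe_finset, card_range]
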